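/- Let n = (V, {·,·}) be a finite-dimensional Lie algebra over a field K of characteristic zero with dim V = n, and let R be a Rota–Baxter operator of weight 1 on n. Set n₁ = ker(Rⁿ), n₂ = ker((R + id)ⁿ), and n₃ = im(Rⁿ) ∩ im((R + id)ⁿ). Then n₁, n₂, n₃ are Lie subalgebras of n, V = n₁ ∔ n₂ ∔ n₃ is a direct vector space sum, {n₁, n₃} ⊆ n₁, {n₂, n₃} ⊆ n₂, and n₃ is a solvable Lie algebra. -/

import Mathlib

/-- A Lie bracket on the `K`-vector space `V`, given as a plain binary product:
it is `K`-bilinear, alternating, and satisfies the Jacobi identity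
(in Leibniz form). -/
def IsLieBr (K : Type*) {V : Type*} [Field K] [CharZero K] [AddCommGroup V] [Module K V]
    (b : V → V → V) : Prop :=
  (∀ x : V, IsLinearMap K (b x)) ∧ (∀ y : V, IsLinearMap K fun x => b x y) ∧
  (∀ x : V, b x x = 0) ∧ ∀ x y z : V, b x (b y z) = b (b x y) z + b y (b x z)

/-- A Rota–Baxter operator of weight `lam` on the Lie algebra `(V, b)`. -/
def IsLieRB (K : Type*) {V : Type*} [Field K] [CharZero K] [AddCommGroup V] [Module K V]
    (b : V → V → V) (R : V →ₗ[K] V) (lam : K) : Prop :=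
  ∀ x y : V, b (R x) (R y) = R (b (R x) y + b x (R y) + lam • b x y)

/-- The bracket `[x,y] = {R x, y} - {R y, x} + {x, y}` induced by an operator `R`
on a Lie algebra `(V, b)`. -/
def indBr {K V : Type*} [Field K] [CharZero K] [AddCommGroup V] [Module K V]
    (b : V → V → V) (R : V →ₗ[K] V) : V → V → V :=
  fun x y => b (R x) y - b (R y) x + b x y

/-- A post-Lie algebra structure on the pair of Lie algebras `(V, gb)` and `(V, nb)`:
a bilinear product `mul` with `x·y - y·x = [x,y] - {x,y}`, `[x,y]·z = x·(y·z) - y·(x·z)`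
and `x·{y,z} = {x·y, z} + {y, x·z}`. -/
def IsPostLie (K : Type*) {V : Type*} [Field K] [CharZero K] [AddCommGroup V] [Module K V]
    (gb nb mul : V → V → V) : Prop :=
  (∀ x : V, IsLinearMap K (mul x)) ∧ (∀ y : V, IsLinearMap K fun x => mul x y) ∧
  (∀ x y : V, mul x y - mul y x = gb x y - nb x y) ∧
  (∀ x y z : V, mul (gb x y) z = mul x (mul y z) - mul y (mul x z)) ∧
  (∀ x y z : V, mul x (nb y z) = nb (mul x y) z + nb y (mul x z))

/-- The derived series of the subspace `I` inside the Lie algebra `(V, b)`. -/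
def derSeriesFrom (K : Type*) {V : Type*} [Field K] [CharZero K] [AddCommGroup V] [Module K V]
    (b : V → V → V) (I : Submodule K V) : ℕ → Submodule K V
  | 0 => I
  | n + 1 => Submodule.span K
      {z | ∃ x ∈ derSeriesFrom K b I n, ∃ y ∈ derSeriesFrom K b I n, z = b x y}

/-! ### Kreknin's theorem for cyclically graded Lie algebras -/

section Kreknin

variable {K L : Type*} [CommRing K] [LieRing L] [LieAlgebra K L] {N : ℕ}

/-- A family of submodules indexed by `ZMod N` which is compatible with the bracket and whose
component of degree zero vanishes. -/
structure IsCyclicFamily (A : ZMod N → Submodule K L) : Prop where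
  zero : A 0 = ⊥
  lie_mem : ∀ i j, ∀ x ∈ A i, ∀ y ∈ A j, ⁅x, y⁆ ∈ A (i + j)

/-- The homogeneous components of the derived algebra of a graded family. -/
def derivedFamily (A : ZMod N → Submodule K L) (k : ZMod N) : Submodule K L :=
  Submodule.span K {z | ∃ i j, i + j = k ∧ ∃ x ∈ A i, ∃ y ∈ A j, ⁅x, y⁆ = z}

/-- The homogeneous elements of the subalgebra generated by the components of degree at
least `k`. -/
inductive GeneratedFrom (A : ZMod N → Submodule K L) (k : ℕ) : ZMod N → L → Prop
  | of (l : ZMod N) (x : L) : k ≤ l.val → x ∈ A l → GeneratedFrom A k l x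
  | zero (l : ZMod N) : GeneratedFrom A k l 0
  | add (l : ZMod N) (x y : L) :
      GeneratedFrom A k l x → GeneratedFrom A k l y → GeneratedFrom A k l (x + y)
  | smul (l : ZMod N) (c : K) (x : L) : GeneratedFrom A k l x → GeneratedFrom A k l (c • x)
  | lie (i j : ZMod N) (x y : L) :
      GeneratedFrom A k i x → GeneratedFrom A k j y → GeneratedFrom A k (i + j) ⁅x, y⁆

namespace IsCyclicFamily

variable {A : ZMod N → Submodule K L}

lemma derivedFamily_le (hA : IsCyclicFamily A) (k : ZMod N) : derivedFamily A k ≤ A k := by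
  refine Submodule.span_le.2 ?_
  rintro _ ⟨i, j, rfl, x, hx, y, hy, rfl⟩
  exact hA.lie_mem i j x hx y hy

lemma derived (hA : IsCyclicFamily A) : IsCyclicFamily (derivedFamily A) where
  zero := le_bot_iff.1 (hA.zero ▸ hA.derivedFamily_le 0)
  lie_mem i j x hx y hy := Submodule.subset_span
    ⟨i, j, rfl, x, hA.derivedFamily_le i hx, y, hA.derivedFamily_le j hy, rfl⟩

lemma iterate (hA : IsCyclicFamily A) (d : ℕ) : IsCyclicFamily (derivedFamily^[d] A) := by
  induction d with
  | zero => exact hA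
  | succ d ih => rw [Function.iterate_succ_apply']; exact ih.derived

lemma iterate_le (hA : IsCyclicFamily A) (d : ℕ) (k : ZMod N) :
    derivedFamily^[d] A k ≤ A k := by
  induction d with
  | zero => exact le_rfl
  | succ d ih =>
    rw [Function.iterate_succ_apply']
    exact ((hA.iterate d).derivedFamily_le k).trans ih

end IsCyclicFamily

lemma GeneratedFrom.lie_mem_span {A : ZMod N → Submodule K L} (hA : IsCyclicFamily A) {k : ℕ}
    {j : ZMod N} {y : L} (hy : GeneratedFrom A k j y) (i : ZMod N) (x : L) (hx : x ∈ A i) :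
    ⁅x, y⁆ ∈ Submodule.span K
      {z | ∃ a l : ZMod N, k ≤ l.val ∧ a + l = i + j ∧ ∃ v ∈ A a, ∃ u ∈ A l, ⁅v, u⁆ = z} := by
  induction hy generalizing i x with
  | of l y hl hy => exact Submodule.subset_span ⟨i, l, hl, rfl, x, hx, y, hy, rfl⟩
  | zero l => simp
  | add l y₁ y₂ _ _ ih₁ ih₂ => rw [lie_add]; exact add_mem (ih₁ i x hx) (ih₂ i x hx)
  | smul l c y _ ih => rw [lie_smul]; exact Submodule.smul_mem _ _ (ih i x hx)
  | lie j₁ j₂ y₁ y₂ h₁ h₂ ih₁ ih₂ =>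
    have mem : ∀ {j : ZMod N} {y : L}, GeneratedFrom A k j y → y ∈ A j := by
      intro j y h
      induction h with
      | of _ _ _ h => exact h
      | zero => exact zero_mem _
      | add _ _ _ _ _ h₁ h₂ => exact add_mem h₁ h₂
      | smul _ _ _ _ h => exact Submodule.smul_mem _ _ h
      | lie _ _ _ _ _ _ h₁ h₂ => exact hA.lie_mem _ _ _ h₁ _ h₂
    have e : ⁅x, ⁅y₁, y₂⁆⁆ = ⁅⁅x, y₁⁆, y₂⁆ - ⁅⁅x, y₂⁆, y₁⁆ := by
      rw [leibniz_lie, ← lie_skew ⁅x, y₂⁆ y₁, sub_neg_eq_add]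
    rw [e]
    have m₁ := ih₂ (i + j₁) _ (hA.lie_mem i j₁ x hx y₁ (mem h₁))
    have m₂ := ih₁ (i + j₂) _ (hA.lie_mem i j₂ x hx y₂ (mem h₂))
    rw [add_assoc] at m₁
    rw [add_assoc, add_comm j₂] at m₂
    exact sub_mem m₁ m₂

lemma GeneratedFrom.of_mem_span {A : ZMod N → Submodule K L} {k : ℕ} {j : ZMod N} {s : Set L}
    (hs : ∀ z ∈ s, GeneratedFrom A k j z) {y : L} (hy : y ∈ Submodule.span K s) :
    GeneratedFrom A k j y := by
  induction hy using Submodule.span_induction with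
  | mem x h => exact hs x h
  | zero => exact .zero j
  | add x y _ _ h₁ h₂ => exact .add j x y h₁ h₂
  | smul c x _ h => exact .smul j c x h

lemma IsCyclicFamily.lie_generatedFrom_succ [NeZero N] {A : ZMod N → Submodule K L}
    (hA : IsCyclicFamily A) {k : ℕ} {i j : ZMod N} (hij : (i + j).val = k) {x y : L}
    (hx : x ∈ A i) (hy : GeneratedFrom A k j y) : GeneratedFrom A (k + 1) (i + j) ⁅x, y⁆ := by
  refine GeneratedFrom.of_mem_span ?_ (hy.lie_mem_span hA i x hx)
  rintro _ ⟨a, l, hl, hal, v, hv, u, hu, rfl⟩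
  rw [← hal] at hij ⊢
  by_cases ha : a = 0
  · subst ha
    rw [hA.zero, Submodule.mem_bot] at hv
    rw [hv, zero_lie]
    exact .zero _
  have ha' : 0 < a.val := Nat.pos_of_ne_zero fun h => ha ((ZMod.val_eq_zero a).1 h)
  have hsum := ZMod.val_add a l
  have hlN := ZMod.val_lt l
  have haN := ZMod.val_lt a
  have key : k < l.val ∧ k < a.val := by
    rcases lt_or_ge (a.val + l.val) N with h | h
    · rw [Nat.mod_eq_of_lt h] at hsum
      omega
    · rw [Nat.mod_eq_sub_mod h, Nat.mod_eq_of_lt (by omega)] at hsum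
      omega
  exact .lie a l v u (.of a v key.2 hv) (.of l u key.1 hu)

variable (K L) in
lemma exists_iterate_derivedFamily_generatedFrom [NeZero N] (k : ℕ) :
    ∃ d : ℕ, ∀ A : ZMod N → Submodule K L, IsCyclicFamily A →
      ∀ i, ∀ x ∈ derivedFamily^[d] A i, GeneratedFrom A k i x := by
  induction k with
  | zero => exact ⟨0, fun A _ i x hx => .of i x (Nat.zero_le _) hx⟩
  | succ k ih =>
    obtain ⟨d, hd⟩ := ih
    refine ⟨d + (d + 1), fun A hA i x hx => ?_⟩
    rw [Function.iterate_add_apply] at hx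
    have hx' := hd _ (hA.iterate (d + 1)) i x hx
    clear hx
    induction hx' with
    | of l x hl hx =>
      rcases hl.lt_or_eq with hl | hl
      · exact .of l x hl (hA.iterate_le _ _ hx)
      · rw [Function.iterate_succ_apply'] at hx
        refine GeneratedFrom.of_mem_span ?_ hx
        rintro _ ⟨a, b, rfl, x, hx, y, hy, rfl⟩
        exact hA.lie_generatedFrom_succ hl.symm (hA.iterate_le d a hx) (hd A hA b y hy)
    | zero l => exact .zero l
    | add l x y _ _ h₁ h₂ => exact .add l x y h₁ h₂
    | smul l c x _ h => exact .smul l c x h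
    | lie i j x y _ _ h₁ h₂ => exact .lie i j x y h₁ h₂

/-- **Kreknin's theorem**: a Lie algebra graded by a finite cyclic group, with trivial component
of degree zero, is solvable. -/
theorem IsCyclicFamily.isSolvable [NeZero N] {A : ZMod N → Submodule K L}
    (hA : IsCyclicFamily A) (htop : ⨆ i, A i = ⊤) : LieAlgebra.IsSolvable L := by
  obtain ⟨d, hd⟩ := exists_iterate_derivedFamily_generatedFrom K L (N := N) N
  have hbot : ∀ i x, GeneratedFrom A N i x → x = 0 := by
    intro i x h
    induction h with
    | of l x hl _ => exact absurd (ZMod.val_lt l) (not_lt.2 hl)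
    | zero => rfl
    | add _ _ _ _ _ h₁ h₂ => rw [h₁, h₂, add_zero]
    | smul _ _ _ _ h => rw [h, smul_zero]
    | lie _ _ _ _ _ _ h₁ _ => rw [h₁, zero_lie]
  have hle : ∀ n, (LieAlgebra.derivedSeries K L n).toSubmodule ≤
      ⨆ i, derivedFamily^[n] A i := by
    intro n
    induction n with
    | zero => simp [htop]
    | succ n ih =>
      rw [LieAlgebra.derivedSeries_def, LieAlgebra.derivedSeriesOfIdeal_succ,
        ← LieAlgebra.derivedSeries_def, LieSubmodule.lieIdeal_oper_eq_linear_span',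
        Submodule.span_le]
      rintro _ ⟨x, hx, y, hy, rfl⟩
      have hx' := ih hx
      have hy' := ih hy
      clear hx hy
      rw [SetLike.mem_coe]
      induction hx' using Submodule.iSup_induction' with
      | mem i x hxi =>
        induction hy' using Submodule.iSup_induction' with
        | mem j y hyj =>
          refine Submodule.mem_iSup_of_mem (i + j) ?_
          rw [Function.iterate_succ_apply']
          exact Submodule.subset_span ⟨i, j, rfl, x, hxi, y, hyj, rfl⟩
        | zero => simp
        | add y z _ _ h₁ h₂ => rw [lie_add]; exact add_mem h₁ h₂
      | zero => simp
      | add y z _ _ h₁ h₂ => rw [add_lie]; exact add_mem h₁ h₂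
  refine LieAlgebra.IsSolvable.mk (R := K) (k := d) ?_
  rw [eq_bot_iff]
  intro x hx
  have hx' := hle d hx
  rw [LieSubmodule.mem_bot]
  have : (⨆ i, derivedFamily^[d] A i) = ⊥ :=
    iSup_eq_bot.2 fun i => (Submodule.eq_bot_iff _).2 fun x hx => hbot i x (hd A hA i x hx)
  simpa [this] using hx'

end Kreknin

/-! ### Discrete logarithms on finite subsets of a field -/

lemma Int.isJacobsonRing : IsJacobsonRing ℤ := by
  refine isJacobsonRing_iff_prime_eq.2 fun P hP => ?_
  by_cases h : P = ⊥
  · subst h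
    refine le_antisymm (fun x hx => ?_) Ideal.le_jacobson
    have hu := Ideal.mem_jacobson_bot.1 hx (3 * x)
    rw [Ideal.mem_bot]
    rcases Int.isUnit_iff.1 hu with h | h <;> nlinarith [sq_nonneg x]
  · have := hP.isMaximal h
    exact Ideal.jacobson_eq_self_of_isMaximal

/-- A field which is finitely generated as a ring is finite. -/
lemma Field.finite_of_finiteType_int (k : Type*) [Field k] [inst : Algebra ℤ k]
    [Algebra.FiniteType ℤ k] :
    Finite k := by
  obtain rfl : inst = Ring.toIntAlgebra k := Subsingleton.elim _ _
  have := Int.isJacobsonRing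
  have hfin : Module.Finite ℤ k := finite_of_finite_type_of_isJacobsonRing ℤ k
  have hnot : ¬ Function.Injective (algebraMap ℤ k) := fun hinj =>
    Int.not_isField (isField_of_isIntegral_of_isField hinj (Field.toIsField k))
  obtain ⟨m, hm, hm0⟩ : ∃ m : ℤ, (m : k) = 0 ∧ m ≠ 0 := by
    by_contra! h
    exact hnot ((injective_iff_map_eq_zero _).2 fun a ha => h a (by simpa using ha))
  refine Module.finite_of_fg_torsion k fun x => ⟨⟨m, mem_nonZeroDivisors_of_ne_zero hm0⟩, ?_⟩
  change m • x = 0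
  rw [zsmul_eq_mul, hm, zero_mul]

universe u in
lemma exists_ringHom_finite_field {F : Type u} [Field F] (S : Finset F) :
    ∃ (B : Subring F) (k : Type u) (_ : Field k) (_ : Finite k) (_ : B →+* k),
      ∀ s ∈ S, s ∈ B ∧ s⁻¹ ∈ B ∧ (s - 1)⁻¹ ∈ B := by
  classical
  let T : Set F := ↑(S ∪ S.image (·⁻¹) ∪ S.image fun s => (s - 1)⁻¹)
  let B := Algebra.adjoin ℤ T
  have hB : Algebra.FiniteType ℤ B := .adjoin_of_finite (Finset.finite_toSet _)
  obtain ⟨m, hm⟩ := Ideal.exists_maximal B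
  let _ := Ideal.Quotient.field m
  have hk : Algebra.FiniteType ℤ (B ⧸ m) :=
    hB.of_surjective (Ideal.Quotient.mkₐ ℤ m) (Ideal.Quotient.mkₐ_surjective ℤ m)
  refine ⟨B.toSubring, B ⧸ m, inferInstance, Field.finite_of_finiteType_int (B ⧸ m),
    Ideal.Quotient.mk m, fun s hs => ⟨?_, ?_, ?_⟩⟩ <;>
  refine Algebra.subset_adjoin ?_ <;> simp [T, hs]

/-- A finite set of elements different from `0` and `1` of a field admits a multiplicative
weight function with non-zero values in a finite cyclic group. -/
lemma exists_cyclic_weight {F : Type*} [Field F] (S : Finset F) (h0 : (0 : F) ∉ S)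
    (h1 : (1 : F) ∉ S) :
    ∃ (N : ℕ) (_ : NeZero N) (φ : F → ZMod N), (∀ s ∈ S, φ s ≠ 0) ∧
      ∀ s ∈ S, ∀ t ∈ S, s * t ∈ S → φ (s * t) = φ s + φ t := by
  classical
  obtain ⟨B, k, _, _, ψ, hB⟩ := exists_ringHom_finite_field S
  have hu : ∀ s : S, ∃ u : kˣ, (u : k) = ψ ⟨s, (hB s s.2).1⟩ := fun s => by
    have hs : (s : F) ≠ 0 := fun h => h0 (h ▸ s.2)
    refine ⟨⟨ψ ⟨s, (hB s s.2).1⟩, ψ ⟨(s : F)⁻¹, (hB s s.2).2.1⟩, ?_, ?_⟩, rfl⟩ <;>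
    · rw [← map_mul, ← map_one ψ]
      congr 1
      exact Subtype.ext (by simp [hs])
  choose u hu using hu
  have hne : ∀ s : S, u s ≠ 1 := fun s h => by
    have hs : (s : F) - 1 ≠ 0 := fun h => h1 (sub_eq_zero.1 h ▸ s.2)
    have e : (⟨s, (hB s s.2).1⟩ - 1 : B) * ⟨((s : F) - 1)⁻¹, (hB s s.2).2.2⟩ = 1 :=
      Subtype.ext (by simp [hs])
    have := congrArg ψ e
    rw [map_mul, map_sub, ← hu, h, map_one, Units.val_one, sub_self, zero_mul] at this
    exact zero_ne_one this
  obtain ⟨g, hg⟩ := IsCyclic.exists_generator (α := kˣ)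
  let e := (zmodMulEquivOfGenerator hg rfl).symm
  refine ⟨Nat.card kˣ, ⟨Nat.card_pos.ne'⟩,
    fun s => if h : s ∈ S then (e (u ⟨s, h⟩)).toAdd else 0, fun s hs => ?_,
    fun s hs t ht hst => ?_⟩
  · simpa [hs] using hne ⟨s, hs⟩
  · have : u ⟨s * t, hst⟩ = u ⟨s, hs⟩ * u ⟨t, ht⟩ := Units.ext <| by
      rw [Units.val_mul, hu, hu, hu, ← map_mul]
      rfl
    simp [hs, ht, hst, this]

/-! ### Fixed-point-free automorphisms -/

section FixedPointFree

variable {K L : Type*} [Field K] [LieRing L] [LieAlgebra K L]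

lemma pow_sub_smul_lie_eq_zero {σ : Module.End K L} (hσ : ∀ x y, σ ⁅x, y⁆ = ⁅σ x, σ y⁆)
    {s t : K} (n a b : ℕ) (hab : a + b ≤ n) (x y : L) (hx : ((σ - s • 1) ^ a) x = 0)
    (hy : ((σ - t • 1) ^ b) y = 0) : ((σ - (s * t) • 1) ^ n) ⁅x, y⁆ = 0 := by
  induction n generalizing a b x y with
  | zero =>
    obtain ⟨rfl, rfl⟩ : a = 0 ∧ b = 0 := by omega
    have : x = 0 := hx
    simp [this]
  | succ n ih =>
    rcases a with _ | a
    · have : x = 0 := hx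
      simp [this]
    rcases b with _ | b
    · have : y = 0 := hy
      simp [this]
    have hcomm : Commute (σ - t • 1) σ :=
      (Commute.refl σ).sub_left ((Commute.one_left σ).smul_left t)
    have key : (σ - (s * t) • 1) ⁅x, y⁆ =
        ⁅(σ - s • 1) x, σ y⁆ + s • ⁅x, (σ - t • 1) y⁆ := by
      simp [hσ, smul_sub, mul_smul]
    rw [pow_succ, Module.End.mul_apply, key, map_add, map_smul,
      ih a (b + 1) (by omega) ((σ - s • 1) x) (σ y) (by rwa [pow_succ] at hx) ?_,
      ih (a + 1) b (by omega) x ((σ - t • 1) y) hx (by rwa [pow_succ] at hy)]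
    · simp
    · rw [← Module.End.mul_apply, (hcomm.pow_left (b + 1)).eq, Module.End.mul_apply, hy, map_zero]

lemma lie_mem_maxGenEigenspace_mul {σ : Module.End K L} (hσ : ∀ x y, σ ⁅x, y⁆ = ⁅σ x, σ y⁆)
    {s t : K} {x y : L} (hx : x ∈ σ.maxGenEigenspace s) (hy : y ∈ σ.maxGenEigenspace t) :
    ⁅x, y⁆ ∈ σ.maxGenEigenspace (s * t) := by
  obtain ⟨a, ha⟩ := (Module.End.mem_maxGenEigenspace _ _ _).1 hx
  obtain ⟨b, hb⟩ := (Module.End.mem_maxGenEigenspace _ _ _).1 hy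
  exact (Module.End.mem_maxGenEigenspace _ _ _).2
    ⟨a + b, pow_sub_smul_lie_eq_zero hσ _ a b le_rfl x y ha hb⟩

lemma maxGenEigenspace_eq_bot_of_injective {σ : Module.End K L} {t : K}
    (h : Function.Injective (σ - t • (1 : Module.End K L))) : σ.maxGenEigenspace t = ⊥ := by
  refine (Submodule.eq_bot_iff _).2 fun x hx => ?_
  obtain ⟨n, hn⟩ := (Module.End.mem_maxGenEigenspace _ _ _).1 hx
  rw [Module.End.pow_apply] at hn
  exact h.iterate n (by rw [hn, Function.iterate_fixed (map_zero _)])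

lemma isSolvable_of_fixedPointFree_of_isAlgClosed [IsAlgClosed K] [FiniteDimensional K L]
    (σ : Module.End K L) (hσ : ∀ x y, σ ⁅x, y⁆ = ⁅σ x, σ y⁆) (h0 : Function.Injective σ)
    (h1 : Function.Injective (σ - (1 : Module.End K L))) : LieAlgebra.IsSolvable L := by
  have hfin : {t | σ.maxGenEigenspace t ≠ ⊥}.Finite :=
    WellFoundedGT.finite_ne_bot_of_iSupIndep σ.independent_maxGenEigenspace
  obtain ⟨N, _, φ, hφ, hφmul⟩ := exists_cyclic_weight hfin.toFinset
    (by simpa using maxGenEigenspace_eq_bot_of_injective (t := 0) (by simpa using h0))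
    (by simpa using maxGenEigenspace_eq_bot_of_injective (t := 1) (by simpa using h1))
  simp only [Set.Finite.mem_toFinset, Set.mem_ofPred_eq] at hφ hφmul
  let A : ZMod N → Submodule K L := fun i =>
    ⨆ t : {t // σ.maxGenEigenspace t ≠ ⊥ ∧ φ t = i}, σ.maxGenEigenspace t
  refine IsCyclicFamily.isSolvable (A := A) ⟨?_, fun i j x hx y hy => ?_⟩ ?_
  · exact iSup_eq_bot.2 fun t => absurd t.2.2 (hφ _ t.2.1)
  · induction hx using Submodule.iSup_induction' with
    | mem s x hx =>
      induction hy using Submodule.iSup_induction' with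
      | mem t y hy =>
        have hmem := lie_mem_maxGenEigenspace_mul hσ hx hy
        by_cases hst : σ.maxGenEigenspace (s.1 * t.1) = ⊥
        · rw [hst, Submodule.mem_bot] at hmem
          rw [hmem]
          exact zero_mem _
        · exact Submodule.mem_iSup_of_mem (p := fun t : {t // σ.maxGenEigenspace t ≠ ⊥ ∧ _} =>
            σ.maxGenEigenspace t) ⟨s.1 * t.1, hst, by
              rw [hφmul _ s.2.1 _ t.2.1 hst, s.2.2, t.2.2]⟩ hmem
      | zero => simp
      | add y z _ _ h₁ h₂ => rw [lie_add]; exact add_mem h₁ h₂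
    | zero => simp
    | add y z _ _ h₁ h₂ => rw [add_lie]; exact add_mem h₁ h₂
  · rw [eq_top_iff, ← Module.End.iSup_maxGenEigenspace_eq_top σ]
    refine iSup_le fun t => ?_
    by_cases ht : σ.maxGenEigenspace t = ⊥
    · simp [ht]
    · exact le_iSup_of_le (φ t) (le_iSup_of_le
        (f := fun s : {s // σ.maxGenEigenspace s ≠ ⊥ ∧ φ s = φ t} => σ.maxGenEigenspace s)
        ⟨t, ht, rfl⟩ le_rfl)

open TensorProduct in
/-- A finite-dimensional Lie algebra with an automorphism fixing only `0` is solvable. -/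
theorem isSolvable_of_fixedPointFree [FiniteDimensional K L]
    (σ : Module.End K L) (hσ : ∀ x y, σ ⁅x, y⁆ = ⁅σ x, σ y⁆) (h0 : Function.Injective σ)
    (h1 : Function.Injective (σ - (1 : Module.End K L))) : LieAlgebra.IsSolvable L := by
  refine (LieAlgebra.isSolvable_tensorProduct_iff K L (A := AlgebraicClosure K)).1 ?_
  have hinj : ∀ f : Module.End K L, Function.Injective f →
      Function.Injective (f.baseChange (AlgebraicClosure K)) := fun f hf =>
    Module.Flat.lTensor_preserves_injective_linearMap f hf
  refine isSolvable_of_fixedPointFree_of_isAlgClosed (K := AlgebraicClosure K)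
    (σ.baseChange (AlgebraicClosure K)) (fun x y => ?_) (hinj σ h0) ?_
  · induction x using TensorProduct.induction_on with
    | zero => simp
    | add x₁ x₂ h₁ h₂ => simp only [add_lie, map_add, h₁, h₂]
    | tmul a x =>
      induction y using TensorProduct.induction_on with
      | zero => simp
      | add y₁ y₂ h₁ h₂ => simp only [lie_add, map_add, h₁, h₂]
      | tmul b y => simp [LieAlgebra.ExtendScalars.bracket_tmul, hσ]
  · have := hinj _ h1
    rwa [LinearMap.baseChange_sub, Module.End.one_eq_id, LinearMap.baseChange_id] at this

end FixedPointFree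

/-! ### Fitting decomposition -/

section Fitting

variable {K V : Type*} [Field K] [AddCommGroup V] [Module K V]

open Module LinearMap

lemma range_pow_finrank_le [FiniteDimensional K V] (f : End K V) (k : ℕ) :
    range (f ^ finrank K V) ≤ range (f ^ k) := by
  have hle : range (f ^ (finrank K V + k)) ≤ range (f ^ finrank K V) := by
    rw [pow_add]
    exact range_comp_le_range _ _
  have hker := End.ker_pow_eq_ker_pow_finrank_of_le (f := f) (Nat.le_add_right (finrank K V) k)
  have h₁ := (f ^ (finrank K V + k)).finrank_range_add_finrank_ker
  have h₂ := (f ^ finrank K V).finrank_range_add_finrank_ker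
  rw [hker] at h₁
  rw [← Submodule.eq_of_le_of_finrank_eq hle (by omega), add_comm, pow_add]
  exact range_comp_le_range _ _

lemma mem_ker_pow_finrank_of_pow_apply [FiniteDimensional K V] {f : End K V} {k : ℕ} {x : V}
    (h : (f ^ k) x = 0) : x ∈ ker (f ^ finrank K V) :=
  End.ker_pow_le_ker_pow_finrank f k h

lemma exists_mem_range_pow_finrank_apply_eq [FiniteDimensional K V] {f : End K V} {x : V}
    (hx : x ∈ range (f ^ finrank K V)) : ∃ y ∈ range (f ^ finrank K V), f y = x := by
  obtain ⟨z, rfl⟩ := range_pow_finrank_le f (finrank K V + 1) hx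
  exact ⟨(f ^ finrank K V) z, mem_range_self _ z, by rw [pow_succ', End.mul_apply]⟩

lemma isCompl_ker_range_pow_finrank [FiniteDimensional K V] (f : End K V) :
    IsCompl (ker (f ^ finrank K V)) (range (f ^ finrank K V)) := by
  refine IsCompl.of_le ?_ ?_
  · rintro _ ⟨hx, y, rfl⟩
    rw [SetLike.mem_coe, mem_ker, ← End.mul_apply, ← pow_add] at hx
    exact mem_ker_pow_finrank_of_pow_apply hx
  · intro x _
    obtain ⟨y, hy⟩ := range_pow_finrank_le f (finrank K V + finrank K V) (mem_range_self _ x)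
    refine Submodule.mem_sup.2 ⟨x - (f ^ finrank K V) y, ?_, _, mem_range_self _ y, by abel⟩
    rw [mem_ker, map_sub, ← hy, pow_add, End.mul_apply, sub_self]

lemma apply_mem_range_pow_of_commute {f g : End K V} (h : Commute f g) (n : ℕ) {x : V}
    (hx : x ∈ range (g ^ n)) : f x ∈ range (g ^ n) := by
  obtain ⟨y, rfl⟩ := hx
  exact ⟨f y, by rw [← End.mul_apply, ← End.mul_apply, (h.pow_right n).eq]⟩

lemma ker_pow_le_range_add_id_pow (f : End K V) (m n : ℕ) :
    ker (f ^ m) ≤ range ((f + LinearMap.id) ^ n) := by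
  intro x hx
  obtain ⟨u, w, h⟩ : IsCoprime ((Polynomial.X : Polynomial K) ^ m) ((Polynomial.X + 1) ^ n) :=
    IsCoprime.pow ⟨-1, 1, by ring⟩
  have h' := congrArg (fun p => Polynomial.aeval f p x) h
  rw [mul_comm w] at h'
  simp only [map_add, map_mul, map_pow, map_one, Polynomial.aeval_X, LinearMap.add_apply,
    End.mul_apply, End.one_apply, mem_ker.1 hx, map_zero, zero_add] at h'
  exact ⟨_, h'⟩

end Fitting

/-! ### Rota–Baxter operators of weight one -/

section RotaBaxter

variable {K V : Type*} [Field K] [CharZero K] [AddCommGroup V] [Module K V]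
  {b : V → V → V} {R : V →ₗ[K] V}

open Module LinearMap

/-- The Lie ring structure on `V` given by a Lie bracket. -/
abbrev IsLieBr.toLieRing (hb : IsLieBr K b) : LieRing V where
  bracket := b
  add_lie x y z := (hb.2.1 z).map_add x y
  lie_add x y z := (hb.1 x).map_add y z
  lie_self := hb.2.2.1
  leibniz_lie := hb.2.2.2

lemma IsLieBr.exists_derSeriesFrom_top_eq_bot [FiniteDimensional K V] (hb : IsLieBr K b)
    (σ : End K V) (hσ : ∀ x y, σ (b x y) = b (σ x) (σ y)) (h0 : Function.Injective σ)
    (h1 : Function.Injective (σ - (1 : End K V))) : ∃ m, derSeriesFrom K b ⊤ m = ⊥ := by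
  let _ : LieRing V := hb.toLieRing
  let _ : LieAlgebra K V := { lie_smul := fun c x y => (hb.1 x).map_smul c y }
  have hsol : LieAlgebra.IsSolvable V := isSolvable_of_fixedPointFree σ hσ h0 h1
  obtain ⟨m, hm⟩ := hsol.solvable K V
  have key : ∀ n, derSeriesFrom K b ⊤ n = (LieAlgebra.derivedSeries K V n).toSubmodule := by
    intro n
    induction n with
    | zero => rfl
    | succ n ih =>
      rw [LieAlgebra.derivedSeries_def, LieAlgebra.derivedSeriesOfIdeal_succ,
        ← LieAlgebra.derivedSeries_def, LieSubmodule.lieIdeal_oper_eq_linear_span', derSeriesFrom,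
        ih]
      congr 1
      ext z
      constructor
      · rintro ⟨x, hx, y, hy, rfl⟩
        exact ⟨x, hx, y, hy, rfl⟩
      · rintro ⟨x, hx, y, hy, rfl⟩
        exact ⟨x, hx, y, hy, rfl⟩
  exact ⟨m, by rw [key, hm]; rfl⟩

lemma derSeriesFrom_eq_map_subtype {W : Submodule K V} {b' : W → W → W}
    (hb' : ∀ x y, (b' x y : V) = b x y) (n : ℕ) :
    derSeriesFrom K b W n = (derSeriesFrom K b' ⊤ n).map W.subtype := by
  induction n with
  | zero => simp [derSeriesFrom]
  | succ n ih =>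
    rw [derSeriesFrom, derSeriesFrom, ih, Submodule.map_span]
    congr 1
    ext z
    constructor
    · rintro ⟨_, ⟨x, hx, rfl⟩, _, ⟨y, hy, rfl⟩, rfl⟩
      exact ⟨b' x y, ⟨x, hx, y, hy, rfl⟩, hb' x y⟩
    · rintro ⟨_, ⟨x, hx, y, hy, rfl⟩, rfl⟩
      exact ⟨x, ⟨x, hx, rfl⟩, y, ⟨y, hy, rfl⟩, hb' x y⟩

namespace IsLieRB

lemma apply_apply (hR : IsLieRB K b R 1) (x y : V) :
    b (R x) (R y) = R (b (R x) y + b x (R y) + b x y) := by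
  simpa using hR x y

lemma add_id_apply (hb : IsLieBr K b) (hR : IsLieRB K b R 1) (x y : V) :
    b ((R + LinearMap.id : V →ₗ[K] V) x) ((R + LinearMap.id : V →ₗ[K] V) y) =
      (R + LinearMap.id : V →ₗ[K] V) (b (R x) y + b x (R y) + b x y) := by
  simp only [LinearMap.add_apply, LinearMap.id_apply, (hb.1 _).map_add, (hb.2.1 _).map_add,
    hR.apply_apply, map_add]
  abel

/-- If `R` is a Rota–Baxter operator of weight one, then so is `-(R + id)`. -/
lemma neg_add_id (hb : IsLieBr K b) (hR : IsLieRB K b R 1) :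
    IsLieRB K b (-(R + LinearMap.id)) 1 := by
  intro x y
  have h := add_id_apply hb hR x y
  simp only [LinearMap.neg_apply, (hb.1 _).map_neg, (hb.2.1 _).map_neg, neg_neg, one_smul]
  rw [h, ← map_neg]
  congr 1
  simp only [LinearMap.add_apply, LinearMap.id_apply, (hb.1 _).map_add, (hb.2.1 _).map_add]
  abel

lemma mem_range_pow_finrank [FiniteDimensional K V] (hR : IsLieRB K b R 1) {x y : V}
    (hx : x ∈ range (R ^ finrank K V)) (hy : y ∈ range (R ^ finrank K V)) :
    b x y ∈ range (R ^ finrank K V) := by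
  suffices h : ∀ k, ∀ x ∈ range (R ^ finrank K V), ∀ y ∈ range (R ^ finrank K V),
      b x y ∈ range (R ^ k) from h _ x hx y hy
  intro k
  induction k with
  | zero => intro x _ y _; exact ⟨b x y, rfl⟩
  | succ k ih =>
    intro x hx y hy
    obtain ⟨u, hu, rfl⟩ := exists_mem_range_pow_finrank_apply_eq hx
    obtain ⟨v, hv, rfl⟩ := exists_mem_range_pow_finrank_apply_eq hy
    obtain ⟨z, hz⟩ := add_mem (add_mem (ih _ hx v hv) (ih u hu _ hy)) (ih u hu v hv)
    exact ⟨z, by rw [hR.apply_apply, ← hz, pow_succ', End.mul_apply]⟩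

lemma mem_ker_pow_finrank [FiniteDimensional K V] (hb : IsLieBr K b) (hR : IsLieRB K b R 1)
    {x y : V} (hx : x ∈ ker (R ^ finrank K V))
    (hy : y ∈ range ((R + LinearMap.id) ^ finrank K V)) : b x y ∈ ker (R ^ finrank K V) := by
  suffices h : ∀ k, ∀ x, (R ^ k) x = 0 → ∀ y ∈ range ((R + LinearMap.id) ^ finrank K V),
      b x y ∈ ker (R ^ finrank K V) from h _ x hx y hy
  intro k
  induction k with
  | zero =>
    intro x hx y _
    have : x = 0 := hx
    rw [this, (hb.2.1 y).map_zero]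
    exact zero_mem _
  | succ k ih =>
    intro x hx y hy
    obtain ⟨v, hv, rfl⟩ := exists_mem_range_pow_finrank_apply_eq hy
    have hcomm : Commute R (R + LinearMap.id) :=
      (Commute.refl R).add_right (Commute.one_right R)
    have hx' : (R ^ k) (R x) = 0 := by rwa [pow_succ, End.mul_apply] at hx
    have hmem : R (b x ((R + LinearMap.id : V →ₗ[K] V) v)) ∈ ker (R ^ finrank K V) := by
      have e : R (b x ((R + LinearMap.id : V →ₗ[K] V) v)) = b (R x) (R v) - R (b (R x) v) := by
        rw [hR.apply_apply, ← map_sub, LinearMap.add_apply, LinearMap.id_apply, (hb.1 x).map_add]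
        congr 1
        abel
      have hRv : R v ∈ range ((R + LinearMap.id) ^ finrank K V) :=
        apply_mem_range_pow_of_commute hcomm _ hv
      rw [e]
      refine sub_mem (ih _ hx' _ hRv) ?_
      have := ih _ hx' v hv
      rw [mem_ker] at this ⊢
      rw [← End.mul_apply, (Commute.pow_self R _).eq, End.mul_apply, this, map_zero]
    refine mem_ker_pow_finrank_of_pow_apply (k := finrank K V + 1) ?_
    rw [pow_succ, End.mul_apply]
    exact hmem

lemma exists_derSeriesFrom_top_eq_bot [FiniteDimensional K V] (hb : IsLieBr K b)
    (hR : IsLieRB K b R 1) (h0 : Function.Injective R)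
    (h1 : Function.Injective (R + LinearMap.id : V →ₗ[K] V)) : ∃ m, derSeriesFrom K b ⊤ m = ⊥ := by
  let e : V ≃ₗ[K] V := LinearEquiv.ofInjectiveEndo R h0
  have he : ∀ x, e x = R x := fun x => rfl
  let σ : End K V := (R + LinearMap.id : V →ₗ[K] V) ∘ₗ e.symm.toLinearMap
  have hσe : ∀ x, σ (R x) = (R + LinearMap.id : V →ₗ[K] V) x := fun x => by
    rw [← he]
    simp [σ]
  refine hb.exists_derSeriesFrom_top_eq_bot σ (fun x y => ?_) (h1.comp e.symm.injective) ?_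
  · obtain ⟨u, rfl⟩ := e.surjective x
    obtain ⟨v, rfl⟩ := e.surjective y
    rw [he, he, hR.apply_apply, hσe, hσe, hσe, add_id_apply hb hR]
  · have : ∀ x, (σ - (1 : End K V)) x = e.symm x := fun x => by
      obtain ⟨u, rfl⟩ := e.surjective x
      rw [LinearMap.sub_apply, he, hσe]
      simp [← he]
    intro x y hxy
    rw [this, this] at hxy
    exact e.symm.injective hxy

end IsLieRB

end RotaBaxter

section Decomposition

variable {K V : Type*} [Field K] [AddCommGroup V] [Module K V]

open Module LinearMap

lemma ker_neg_pow (f : End K V) (n : ℕ) : ker ((-f) ^ n) = ker (f ^ n) := by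
  ext x
  rcases n.even_or_odd with h | h <;> simp [h.neg_pow]

lemma range_neg_pow (f : End K V) (n : ℕ) : range ((-f) ^ n) = range (f ^ n) := by
  rcases n.even_or_odd with h | h
  · rw [h.neg_pow]
  · rw [h.neg_pow, range_neg]

lemma ker_add_id_pow_le_range_pow (f : End K V) (m n : ℕ) :
    ker ((f + LinearMap.id) ^ m) ≤ range (f ^ n) := by
  have h := ker_pow_le_range_add_id_pow (-(f + LinearMap.id)) m n
  rwa [ker_neg_pow, neg_add_rev, neg_add_cancel_comm, range_neg_pow] at h

end Decomposition

namespace IsLieRB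

variable {K V : Type*} [Field K] [CharZero K] [AddCommGroup V] [Module K V]
  [FiniteDimensional K V] {b : V → V → V} {R : V →ₗ[K] V}

open Module LinearMap

lemma mem_range_add_id_pow_finrank (hb : IsLieBr K b) (hR : IsLieRB K b R 1) {x y : V}
    (hx : x ∈ range ((R + LinearMap.id) ^ finrank K V))
    (hy : y ∈ range ((R + LinearMap.id) ^ finrank K V)) :
    b x y ∈ range ((R + LinearMap.id) ^ finrank K V) := by
  rw [← range_neg_pow] at hx hy ⊢
  exact (neg_add_id hb hR).mem_range_pow_finrank hx hy

lemma mem_ker_add_id_pow_finrank (hb : IsLieBr K b) (hR : IsLieRB K b R 1) {x y : V}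
    (hx : x ∈ ker ((R + LinearMap.id) ^ finrank K V)) (hy : y ∈ range (R ^ finrank K V)) :
    b x y ∈ ker ((R + LinearMap.id) ^ finrank K V) := by
  rw [← ker_neg_pow] at hx ⊢
  refine mem_ker_pow_finrank hb (neg_add_id hb hR) hx ?_
  rwa [neg_add_rev, neg_add_cancel_comm, range_neg_pow]

lemma exists_derSeriesFrom_range_inf_range_eq_bot (hb : IsLieBr K b) (hR : IsLieRB K b R 1) :
    ∃ m, derSeriesFrom K b (range (R ^ finrank K V) ⊓
      range ((R + LinearMap.id) ^ finrank K V)) m = ⊥ := by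
  set W := range (R ^ finrank K V) ⊓ range ((R + LinearMap.id) ^ finrank K V) with hW
  have hcomm : Commute R (R + LinearMap.id) :=
    (Commute.refl R).add_right (Commute.one_right R)
  have hRW : ∀ x ∈ W, R x ∈ W := fun x hx =>
    ⟨apply_mem_range_pow_of_commute (Commute.refl R) _ hx.1,
      apply_mem_range_pow_of_commute hcomm _ hx.2⟩
  let b' : W → W → W := fun x y =>
    ⟨b x y, hR.mem_range_pow_finrank x.2.1 y.2.1, mem_range_add_id_pow_finrank hb hR x.2.2 y.2.2⟩
  have hb' : IsLieBr K b' := by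
    refine ⟨fun x => ⟨fun y z => ?_, fun c y => ?_⟩, fun y => ⟨fun x z => ?_, fun c x => ?_⟩,
      fun x => ?_, fun x y z => ?_⟩ <;> apply Subtype.ext
    · exact (hb.1 x).map_add y z
    · exact (hb.1 x).map_smul c y
    · exact (hb.2.1 y).map_add x z
    · exact (hb.2.1 y).map_smul c x
    · exact hb.2.2.1 x
    · exact hb.2.2.2 x y z
  have hR' : IsLieRB K b' (R.restrict hRW) 1 := fun x y => Subtype.ext (hR x y)
  have h0 : Function.Injective (R.restrict hRW) := by
    refine (injective_iff_map_eq_zero _).2 fun x hx => Subtype.ext ?_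
    have hx0 : (R ^ 1) (x : V) = 0 := congrArg Subtype.val hx
    exact (Submodule.disjoint_def.1 (isCompl_ker_range_pow_finrank R).disjoint) _
      (mem_ker_pow_finrank_of_pow_apply hx0) x.2.1
  have h1 : Function.Injective (R.restrict hRW + LinearMap.id : W →ₗ[K] W) := by
    refine (injective_iff_map_eq_zero _).2 fun x hx => Subtype.ext ?_
    have hx0 : ((R + LinearMap.id : End K V) ^ 1) (x : V) = 0 := congrArg Subtype.val hx
    exact (Submodule.disjoint_def.1 (isCompl_ker_range_pow_finrank (R + LinearMap.id)).disjoint) _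
      (mem_ker_pow_finrank_of_pow_apply hx0) x.2.2
  obtain ⟨m, hm⟩ := exists_derSeriesFrom_top_eq_bot hb' hR' h0 h1
  exact ⟨m, by rw [derSeriesFrom_eq_map_subtype (b' := b') (fun _ _ => rfl), hm, Submodule.map_bot]⟩

end IsLieRB

theorem rb_triple_decomposition (K : Type*) {V : Type*} [Field K] [CharZero K]
    [AddCommGroup V] [Module K V] [FiniteDimensional K V]
    (nb : V → V → V) (hn : IsLieBr K nb)
    (R : V →ₗ[K] V) (hR : IsLieRB K nb R 1) :
    ∀ n₁ n₂ n₃ : Submodule K V,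
      n₁ = LinearMap.ker (R ^ Module.finrank K V) →
      n₂ = LinearMap.ker ((R + LinearMap.id) ^ Module.finrank K V) →
      n₃ = LinearMap.range (R ^ Module.finrank K V) ⊓
            LinearMap.range ((R + LinearMap.id) ^ Module.finrank K V) →
      -- `n₁`, `n₂`, `n₃` are Lie subalgebras of `n`
      (∀ x ∈ n₁, ∀ y ∈ n₁, nb x y ∈ n₁) ∧
      (∀ x ∈ n₂, ∀ y ∈ n₂, nb x y ∈ n₂) ∧
      (∀ x ∈ n₃, ∀ y ∈ n₃, nb x y ∈ n₃) ∧
      -- `V = n₁ ∔ n₂ ∔ n₃` is a direct vector space sum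
      (n₁ ⊓ n₂ = ⊥) ∧ ((n₁ ⊔ n₂) ⊓ n₃ = ⊥) ∧ (n₁ ⊔ n₂ ⊔ n₃ = ⊤) ∧
      -- `{n₁, n₃} ⊆ n₁` and `{n₂, n₃} ⊆ n₂`
      (∀ x ∈ n₁, ∀ y ∈ n₃, nb x y ∈ n₁) ∧
      (∀ x ∈ n₂, ∀ y ∈ n₃, nb x y ∈ n₂) ∧
      -- `n₃` is solvable
      (∃ m : ℕ, derSeriesFrom K nb n₃ m = ⊥) := by
  rintro _ _ _ rfl rfl rfl
  have hle₁ := ker_pow_le_range_add_id_pow R (Module.finrank K V) (Module.finrank K V)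
  have hle₂ := ker_add_id_pow_le_range_pow R (Module.finrank K V) (Module.finrank K V)
  have hc₁ := isCompl_ker_range_pow_finrank R
  have hc₂ := isCompl_ker_range_pow_finrank (R + LinearMap.id)
  have hd₁ := Submodule.disjoint_def.1 hc₁.disjoint
  have hd₂ := Submodule.disjoint_def.1 hc₂.disjoint
  refine ⟨fun x hx y hy => hR.mem_ker_pow_finrank hn hx (hle₁ hy),
    fun x hx y hy => hR.mem_ker_add_id_pow_finrank hn hx (hle₂ hy),
    fun x hx y hy => ⟨hR.mem_range_pow_finrank hx.1 hy.1,
      hR.mem_range_add_id_pow_finrank hn hx.2 hy.2⟩,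
    (hc₁.disjoint.mono_right hle₂).eq_bot, ?_, ?_,
    fun x hx y hy => hR.mem_ker_pow_finrank hn hx hy.2,
    fun x hx y hy => hR.mem_ker_add_id_pow_finrank hn hx hy.1,
    hR.exists_derSeriesFrom_range_inf_range_eq_bot hn⟩
  · rw [eq_bot_iff]
    rintro _ ⟨hz, hz₁, hz₂⟩
    obtain ⟨x, hx, y, hy, rfl⟩ := Submodule.mem_sup.1 hz
    rw [hd₁ x hx ((Submodule.add_mem_iff_left _ (hle₂ hy)).1 hz₁),
      hd₂ y hy ((Submodule.add_mem_iff_right _ (hle₁ hx)).1 hz₂), add_zero]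
    exact zero_mem _
  · rw [eq_top_iff]
    intro v _
    obtain ⟨x, hx, c, hc, rfl⟩ :=
      Submodule.mem_sup.1 (hc₁.sup_eq_top.ge (Submodule.mem_top (x := v)))
    obtain ⟨y, hy, z, hz, rfl⟩ :=
      Submodule.mem_sup.1 (hc₂.sup_eq_top.ge (Submodule.mem_top (x := c)))
    rw [← add_assoc]
    exact Submodule.add_mem_sup (Submodule.add_mem_sup hx hy)
      ⟨(Submodule.add_mem_iff_right _ (hle₂ hy)).1 hc, hz⟩
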